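/- Consider the example channel with parameter p ∈ (0,1). There do not exist a finite set U, a conditional pmf P_{U|S} on U given S, and a function x : U × S → {1,2,3,4} such that, for the joint distribution in which S ∼ P_S, U has conditional law P_{U|S}(·|S), X = x(U,S), and Y₁, Y₂ are the deterministic channel outputs of (X,S), both I(U;Y₁) − I(U;S) = 2 − 2p and I(U;Y₂) − I(U;S) = 1 − p hold. -/

import Mathlib

open scoped BigOperators

noncomputable section

/-- A probability mass function on a finite type. -/
def IsPMF {α : Type*} [Fintype α] (p : α → ℝ) : Prop :=
  (∀ a, 0 ≤ p a) ∧ ∑ a, p a = 1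

/-- Shannon entropy (base 2), with the convention `0 * log₂ 0 = 0`. -/
def ent {α : Type*} [Fintype α] (p : α → ℝ) : ℝ :=
  -∑ a, p a * Real.logb 2 (p a)

/-- Marginal of a joint pmf on the second component. -/
def margSnd {α β : Type*} [Fintype α] [Fintype β] (p : α × β → ℝ) : β → ℝ :=
  fun b => ∑ a, p (a, b)

/-- Marginal of a joint pmf on the first component. -/
def margFst {α β : Type*} [Fintype α] [Fintype β] (p : α × β → ℝ) : α → ℝ :=
  fun a => ∑ b, p (a, b)

/-- Conditional entropy H(X|Y) of a joint pmf on α × β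
(terms with `p (a, b) = 0` vanish since `0 * log₂ _ = 0`). -/
def condEnt {α β : Type*} [Fintype α] [Fintype β] (p : α × β → ℝ) : ℝ :=
  -∑ a, ∑ b, p (a, b) * Real.logb 2 (p (a, b) / margSnd p b)

/-- Mutual information I(X;Y) = H(X) - H(X|Y) of a joint pmf on α × β. -/
def mutInfo {α β : Type*} [Fintype α] [Fintype β] (p : α × β → ℝ) : ℝ :=
  ent (margFst p) - condEnt p

/-- Pushforward of a pmf along a map. -/
def pushPMF {α β : Type*} [Fintype α] [DecidableEq β] (p : α → ℝ) (f : α → β) : β → ℝ :=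
  fun b => ∑ a, if f a = b then p a else 0

/-- Entropy H(A) of a random variable A on the finite probability space (Ω, p). -/
def entOf {Ω α : Type*} [Fintype Ω] [Fintype α] [DecidableEq α] (p : Ω → ℝ) (A : Ω → α) : ℝ :=
  ent (pushPMF p A)

/-- Conditional entropy H(A|B) of random variables on (Ω, p). -/
def condEntOf {Ω α β : Type*} [Fintype Ω] [Fintype α] [Fintype β] [DecidableEq α] [DecidableEq β]
    (p : Ω → ℝ) (A : Ω → α) (B : Ω → β) : ℝ :=
  condEnt (pushPMF p (fun ω => (A ω, B ω)))

/-- Mutual information I(A;B) of random variables on (Ω, p). -/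
def mutInfoOf {Ω α β : Type*} [Fintype Ω] [Fintype α] [Fintype β] [DecidableEq α] [DecidableEq β]
    (p : Ω → ℝ) (A : Ω → α) (B : Ω → β) : ℝ :=
  entOf p A - condEntOf p A B

/-- Conditional mutual information I(A;B|C) = H(A|C) - H(A|(B,C)). -/
def condMutInfoOf {Ω α β γ : Type*} [Fintype Ω] [Fintype α] [Fintype β] [Fintype γ]
    [DecidableEq α] [DecidableEq β] [DecidableEq γ]
    (p : Ω → ℝ) (A : Ω → α) (B : Ω → β) (C : Ω → γ) : ℝ :=
  condEntOf p A C - condEntOf p A (fun ω => (B ω, C ω))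

/-- Bhattacharyya parameter Z(X|Y) = 2 ∑_y √(p(0,y) p(1,y)) for binary X. -/
def bhat {β : Type*} [Fintype β] (p : ZMod 2 × β → ℝ) : ℝ :=
  2 * ∑ b, Real.sqrt (p (0, b) * p (1, b))

/-- State pmf of the example channel: `P_S(0) = 1-p`, `P_S(s) = p/4` for `s ≠ 0`.
The state alphabet `{0,1,2,3,4}` is modelled by `Fin 5`. -/
def exPS (p : ℝ) : Fin 5 → ℝ := fun s => if s = 0 then 1 - p else p / 4

/-- First output of the example channel: `Y₁ = X` if `S = 0`, `Y₁ = S` otherwise.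
The input/output alphabet `{1,2,3,4}` is modelled by `Fin 4` (index `i ↦ symbol i+1`),
so state symbol `s ≠ 0` corresponds to output index `s - 1`. -/
def exY1 (x : Fin 4) (s : Fin 5) : Fin 4 :=
  if (s : ℕ) = 0 then x else ⟨(s : ℕ) - 1, by have := s.isLt; omega⟩

/-- Second output of the example channel: `Y₂ = 0` if `Y₁ ∈ {1,2}`, `Y₂ = 1` if
`Y₁ ∈ {3,4}` (i.e. output indices `{0,1}` vs `{2,3}`). -/
def exY2 (y : Fin 4) : Bool := decide (2 ≤ (y : ℕ))

/-- Equality case of Gibbs' inequality: a pmf `q` whose divergence from a subpmf `r`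
is nonpositive coincides with `r`. -/
theorem eq_of_sum_mul_logb_nonneg {α : Type*} [Fintype α] {q r : α → ℝ} (hq : IsPMF q)
    (hr : ∀ a, 0 ≤ r a) (hr1 : ∑ a, r a ≤ 1) (hqr : ∀ a, 0 < q a → 0 < r a)
    (h : 0 ≤ ∑ a, q a * Real.logb 2 (r a / q a)) : q = r := by
  have hlog : 0 ≤ ∑ a, q a * Real.log (r a / q a) := by
    have heq : ∑ a, q a * Real.logb 2 (r a / q a)
        = (∑ a, q a * Real.log (r a / q a)) / Real.log 2 := by
      rw [Finset.sum_div]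
      exact Finset.sum_congr rfl fun a _ => by rw [Real.logb, mul_div_assoc]
    rw [heq] at h
    have h2 : 0 < Real.log 2 := Real.log_pos one_lt_two
    by_contra! hneg
    exact absurd h (not_le.mpr (div_neg_of_neg_of_pos hneg h2))
  have hle : ∀ a, 0 ≤ r a - q a - q a * Real.log (r a / q a) := by
    intro a
    rcases (hq.1 a).eq_or_lt with h0 | hpos
    · simpa [← h0] using hr a
    · have h1 := mul_le_mul_of_nonneg_left
        (Real.log_le_sub_one_of_pos (div_pos (hqr a hpos) hpos)) hpos.le
      have h2 : q a * (r a / q a - 1) = r a - q a := by field_simp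
      linarith
  have hsum : ∑ a, (r a - q a - q a * Real.log (r a / q a)) = 0 := by
    refine le_antisymm ?_ (Finset.sum_nonneg fun a _ => hle a)
    rw [Finset.sum_sub_distrib, Finset.sum_sub_distrib, hq.2]
    linarith
  have hzero := (Finset.sum_eq_zero_iff_of_nonneg fun a _ => hle a).mp hsum
  funext a
  have ha := hzero a (Finset.mem_univ a)
  rcases (hq.1 a).eq_or_lt with h0 | hpos
  · rw [← h0] at ha ⊢
    simpa using ha.symm
  · by_contra hne
    have hne1 : r a / q a ≠ 1 := fun h1 => hne ((div_eq_one_iff_eq hpos.ne').mp h1).symm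
    have h1 := mul_lt_mul_of_pos_left
      (Real.log_lt_sub_one_of_pos (div_pos (hqr a hpos) hpos) hne1) hpos
    have h2 : q a * (r a / q a - 1) = r a - q a := by field_simp
    linarith

theorem sum_pushPMF_mul {α β : Type*} [Fintype α] [Fintype β] [DecidableEq β] (p : α → ℝ)
    (f : α → β) (F : β → ℝ) : ∑ b, pushPMF p f b * F b = ∑ a, p a * F (f a) := by
  simp only [pushPMF, Finset.sum_mul]
  rw [Finset.sum_comm]
  simp

theorem le_pushPMF {α β : Type*} [Fintype α] [DecidableEq β] {p : α → ℝ}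
    (hp : ∀ a, 0 ≤ p a) (f : α → β) (a : α) : p a ≤ pushPMF p f (f a) := by
  have h := Finset.single_le_sum (f := fun a' => if f a' = f a then p a' else 0)
    (fun a' _ => by split_ifs <;> simp [hp]) (Finset.mem_univ a)
  simpa [pushPMF] using h

theorem pushPMF_nonneg {α β : Type*} [Fintype α] [DecidableEq β] {p : α → ℝ}
    (hp : ∀ a, 0 ≤ p a) (f : α → β) (b : β) : 0 ≤ pushPMF p f b :=
  Finset.sum_nonneg fun a _ => by split_ifs <;> simp [hp]

theorem margSnd_pushPMF {Ω α β : Type*} [Fintype Ω] [Fintype α] [Fintype β] [DecidableEq α]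
    [DecidableEq β] (p : Ω → ℝ) (A : Ω → α) (B : Ω → β) :
    margSnd (pushPMF p fun ω => (A ω, B ω)) = pushPMF p B := by
  funext b
  simp only [margSnd, pushPMF, Prod.mk.injEq]
  rw [Finset.sum_comm]
  refine Finset.sum_congr rfl fun ω _ => ?_
  by_cases h : B ω = b <;> simp [h]

theorem condEntOf_eq_sum {Ω α β : Type*} [Fintype Ω] [Fintype α] [Fintype β] [DecidableEq α]
    [DecidableEq β] (p : Ω → ℝ) (A : Ω → α) (B : Ω → β) :
    condEntOf p A B = -∑ ω, p ω * Real.logb 2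
      (pushPMF p (fun ω => (A ω, B ω)) (A ω, B ω) / pushPMF p B (B ω)) := by
  rw [condEntOf, condEnt, margSnd_pushPMF, ← Fintype.sum_prod_type', ← sum_pushPMF_mul p
    (fun ω => (A ω, B ω)) (fun c => Real.logb 2 (pushPMF p (fun ω => (A ω, B ω)) c /
      pushPMF p B c.2))]

/-- If the rate `I(U;Y) - I(U;S)` attains its maximum `(1-p) log |Y|` for an output `Y` that equals
`g S` whenever `S ≠ 0`, then the posterior `W` of `U` given `Y` agrees with the law of `U` given
`S = s ≠ 0`, and under it `U` determines `Y` through its value at `S = 0`. -/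
theorem exists_posterior_of_rate_eq {p : ℝ} (hp0 : 0 < p) (hp1 : p < 1) {U Y : Type}
    [Fintype U] [DecidableEq U] [Fintype Y] [DecidableEq Y] [Nonempty Y]
    (PU : Fin 5 → U → ℝ) (hPU : ∀ s, IsPMF (PU s)) (y : U → Fin 5 → Y) (g : Fin 5 → Y)
    (hg : ∀ u s, s ≠ 0 → y u s = g s)
    (h : mutInfoOf (fun ω : U × Fin 5 => exPS p ω.2 * PU ω.2 ω.1) (fun ω => ω.1)
          (fun ω => y ω.1 ω.2)
        - mutInfoOf (fun ω : U × Fin 5 => exPS p ω.2 * PU ω.2 ω.1) (fun ω => ω.1)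
          (fun ω => ω.2) = (1 - p) * Real.logb 2 (Fintype.card Y)) :
    ∃ W : U → Y → ℝ, (∀ u s, s ≠ 0 → PU s u = W u (g s)) ∧
      ∀ u z, y u 0 ≠ z → W u z = 0 := by
  have hPpos : ∀ s, 0 < exPS p s := fun s => by
    unfold exPS; split_ifs <;> linarith
  have hPsum : ∑ s, exPS p s = 1 := by
    simp [exPS, Fin.sum_univ_succ]; ring
  set q : U × Fin 5 → ℝ := fun ω => exPS p ω.2 * PU ω.2 ω.1 with hqdef
  have hq0 : ∀ ω, 0 ≤ q ω := fun ω => mul_nonneg (hPpos _).le ((hPU _).1 _)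
  have hqs : ∀ s, ∑ u, q (u, s) = exPS p s := fun s => by
    simp only [hqdef, ← Finset.mul_sum, (hPU s).2, mul_one]
  have hq : IsPMF q := ⟨hq0, by rw [Fintype.sum_prod_type_right]; simp only [hqs, hPsum]⟩
  set Q : U × Y → ℝ := pushPMF q fun ω => (ω.1, y ω.1 ω.2) with hQdef
  set R : Y → ℝ := pushPMF q fun ω => y ω.1 ω.2 with hRdef
  have hRQ : ∀ z, ∑ u, Q (u, z) = R z := fun z =>
    congrFun (margSnd_pushPMF q (fun ω => ω.1) fun ω => y ω.1 ω.2) z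
  have hQ0 : ∀ c, 0 ≤ Q c := pushPMF_nonneg hq0 _
  have hR0 : ∀ z, 0 ≤ R z := pushPMF_nonneg hq0 _
  set W : U → Y → ℝ := fun u z => Q (u, z) / R z with hWdef
  have hW0 : ∀ u z, 0 ≤ W u z := fun u z => div_nonneg (hQ0 _) (hR0 _)
  have hW1 : ∀ z, ∑ u, W u z ≤ 1 := fun z => by
    simp only [hWdef, ← Finset.sum_div, hRQ]
    exact div_self_le_one _
  have hWpos : ∀ ω, 0 < q ω → 0 < W ω.1 (y ω.1 ω.2) := fun ω hω =>
    div_pos (hω.trans_le (le_pushPMF hq0 (fun ω => (ω.1, y ω.1 ω.2)) ω))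
      (hω.trans_le (le_pushPMF hq0 (fun ω => y ω.1 ω.2) ω))
  set K : ℝ := (Fintype.card Y : ℝ) with hKdef
  have hK : 0 < K := by simp [hKdef, Fintype.card_pos]
  set c : Fin 5 → ℝ := fun s => if s = 0 then K⁻¹ else 1 with hcdef
  have hc : ∀ s, 0 < c s := fun s => by
    simp only [hcdef]; split_ifs <;> positivity
  set r : U × Fin 5 → ℝ := fun ω => c ω.2 * exPS p ω.2 * W ω.1 (y ω.1 ω.2) with hrdef
  have hWK : ∑ u, ∑ z, W u z ≤ K := by
    rw [Finset.sum_comm]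
    exact (Finset.sum_le_sum fun z _ => hW1 z).trans (by simp [hKdef])
  have hW0K : ∑ u, W u (y u 0) ≤ K :=
    (Finset.sum_le_sum fun u _ => Finset.single_le_sum (f := fun z => W u z)
      (fun z _ => hW0 u z) (Finset.mem_univ (y u 0))).trans hWK
  have hr1 : ∑ ω, r ω ≤ 1 := by
    rw [Fintype.sum_prod_type_right, ← hPsum]
    refine Finset.sum_le_sum fun s _ => ?_
    simp only [hrdef, ← Finset.mul_sum]
    by_cases hs : s = 0
    · subst hs
      have h1 : c 0 * ∑ u, W u (y u 0) ≤ 1 := by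
        simp only [hcdef, if_true]
        rw [inv_mul_le_iff₀ hK]; linarith
      nlinarith [hPpos 0]
    · simp only [hg _ s hs, hcdef, if_neg hs, one_mul]
      nlinarith [hPpos s, hW1 (g s)]
  have hqq : pushPMF q (fun ω => (ω.1, ω.2)) = q := by
    funext ω; simp [pushPMF]
  have hqS : pushPMF q (fun ω => ω.2) = exPS p := by
    funext s
    rw [← hqs s, ← margSnd_pushPMF q (fun ω => ω.1) (fun ω => ω.2), hqq]
    rfl
  have hrate : ∑ ω, q ω * Real.logb 2 (r ω / q ω) = 0 := by
    rw [mutInfoOf, mutInfoOf, condEntOf_eq_sum, condEntOf_eq_sum, hqq, hqS] at h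
    have hlogc : ∑ ω, q ω * Real.logb 2 (c ω.2) = -((1 - p) * Real.logb 2 K) := by
      rw [Fintype.sum_prod_type_right]
      simp only [← Finset.sum_mul, hqs]
      rw [Finset.sum_eq_single 0]
      · simp [exPS, hcdef, Real.logb_inv]
      · intro s _ hs; simp [hcdef, hs]
      · simp
    have hsplit : ∀ ω, q ω * Real.logb 2 (r ω / q ω) = q ω * Real.logb 2 (c ω.2)
        + q ω * Real.logb 2 (W ω.1 (y ω.1 ω.2)) - q ω * Real.logb 2 (q ω / exPS p ω.2) := by
      intro ω
      rcases (hq0 ω).eq_or_lt with h0 | hpos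
      · simp [← h0]
      · have hr : r ω / q ω = c ω.2 * W ω.1 (y ω.1 ω.2) / (q ω / exPS p ω.2) := by
          have := hPpos ω.2
          simp only [hrdef]; field_simp
        rw [hr, Real.logb_div (mul_pos (hc _) (hWpos ω hpos)).ne'
          (div_pos hpos (hPpos _)).ne', Real.logb_mul (hc _).ne' (hWpos ω hpos).ne']
        ring
    simp only [hsplit]
    rw [Finset.sum_sub_distrib, Finset.sum_add_distrib, hlogc]
    simp only [hWdef]
    linarith
  have hqr : q = r := eq_of_sum_mul_logb_nonneg hq
    (fun ω => mul_nonneg (mul_pos (hc _) (hPpos _)).le (hW0 _ _)) hr1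
    (fun ω hω => mul_pos (mul_pos (hc _) (hPpos _)) (hWpos ω hω)) hrate.ge
  refine ⟨W, fun u s hs => ?_, fun u z huz => ?_⟩
  · have h1 := congrFun hqr (u, s)
    simp only [hqdef, hrdef, hcdef, if_neg hs, one_mul, hg u s hs] at h1
    exact mul_left_cancel₀ (hPpos s).ne' h1
  · have hsum : ∑ u, W u (y u 0) = K := by
      have h1 : ∑ u, r (u, 0) = exPS p 0 := by rw [← hqr, hqs]
      simp only [hrdef, ← Finset.mul_sum, hcdef, if_true] at h1
      have := hPpos 0
      field_simp at h1
      linarith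
    have hterm : ∀ u, 0 ≤ (∑ z, W u z) - W u (y u 0) := fun u => sub_nonneg.mpr
      (Finset.single_le_sum (f := fun z => W u z) (fun z _ => hW0 u z) (Finset.mem_univ (y u 0)))
    have htot : ∑ u, ((∑ z, W u z) - W u (y u 0)) = 0 := by
      refine le_antisymm ?_ (Finset.sum_nonneg fun u _ => hterm u)
      rw [Finset.sum_sub_distrib]
      linarith
    have hu := (Finset.sum_eq_zero_iff_of_nonneg fun u _ => hterm u).mp htot u (Finset.mem_univ u)
    have hpair := Finset.add_le_sum (s := Finset.univ) (f := fun z => W u z)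
      (fun z _ => hW0 u z) (Finset.mem_univ (y u 0)) (Finset.mem_univ z) huz
    exact le_antisymm (by linarith) (hW0 u z)

/-- for the example channel with `p ∈ (0,1)`, no finite auxiliary `U`
(with conditional pmf `P_{U|S}` and input map `x(U,S)`) simultaneously attains
`I(U;Y₁) − I(U;S) = 2 − 2p` and `I(U;Y₂) − I(U;S) = 1 − p`. -/
theorem example_channel_single_aux_impossible (p : ℝ) (hp0 : 0 < p) (hp1 : p < 1)
    (U : Type) [Fintype U] [DecidableEq U]
    (PU : Fin 5 → U → ℝ) (hPU : ∀ s, IsPMF (PU s))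
    (xf : U → Fin 5 → Fin 4) :
    ¬ ((mutInfoOf (fun ω : U × Fin 5 => exPS p ω.2 * PU ω.2 ω.1)
          (fun ω => ω.1) (fun ω => exY1 (xf ω.1 ω.2) ω.2)
        - mutInfoOf (fun ω : U × Fin 5 => exPS p ω.2 * PU ω.2 ω.1)
          (fun ω => ω.1) (fun ω => ω.2)
        = 2 - 2 * p) ∧
      (mutInfoOf (fun ω : U × Fin 5 => exPS p ω.2 * PU ω.2 ω.1)
          (fun ω => ω.1) (fun ω => exY2 (exY1 (xf ω.1 ω.2) ω.2))
        - mutInfoOf (fun ω : U × Fin 5 => exPS p ω.2 * PU ω.2 ω.1)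
          (fun ω => ω.1) (fun ω => ω.2)
        = 1 - p)) := by
  rintro ⟨h1, h2⟩
  have hlog4 : Real.logb 2 4 = 2 := by
    rw [show (4 : ℝ) = 2 ^ (2 : ℕ) by norm_num, Real.logb_pow, Real.logb_self_eq_one one_lt_two]
    norm_num
  have hY : ∀ u s, s ≠ 0 → exY1 (xf u s) s = exY1 0 s := by
    intro u s hs
    have : (s : ℕ) ≠ 0 := fun h => hs (Fin.ext h)
    simp [exY1, this]
  obtain ⟨W₁, hW₁, hdet⟩ := exists_posterior_of_rate_eq hp0 hp1 PU hPU
    (fun u s => exY1 (xf u s) s) (fun s => exY1 0 s) hY (by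
      rw [h1, Fintype.card_fin]; push_cast; rw [hlog4]; ring)
  obtain ⟨W₂, hW₂, -⟩ := exists_posterior_of_rate_eq hp0 hp1 PU hPU
    (fun u s => exY2 (exY1 (xf u s) s)) (fun s => exY2 (exY1 0 s))
    (fun u s hs => by rw [hY u s hs]) (by
      rw [h2, Fintype.card_bool]; push_cast; rw [Real.logb_self_eq_one one_lt_two]; ring)
  have hzero : ∀ u, PU 1 u = 0 := by
    intro u
    have h12 : PU 1 u = PU 2 u := by
      rw [hW₂ u 1 (by decide), hW₂ u 2 (by decide)]
      rfl
    by_cases hu : exY1 (xf u 0) 0 = exY1 0 1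
    · rw [h12, hW₁ u 2 (by decide)]
      exact hdet u _ (by rw [hu]; decide)
    · rw [hW₁ u 1 (by decide)]
      exact hdet u _ hu
  have hsum := (hPU 1).2
  simp [hzero] at hsum
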